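/- arXiv:2209.12825 — 12 statements merged into one kernel-verified Lean document; each statement's English description precedes it below -/
import Mathlib

section
/- Let I and C be disjoint finite sets of variables and let F be a set of clauses, each of the form E → m or E → ⊥ with E ⊆ I and m ∈ C. Then for every E ⊆ I and m ∈ C: F entails the clause E → m if and only if F contains a clause E' → m or a clause E' → ⊥ with E' ⊆ E; and F entails E → ⊥ if and only if F contains a clause E' → ⊥ with E' ⊆ E. -/
variable {V : Type*}

/-- A clause `(E, some m)` means `E → m`; a clause `(E, none)` means `E → ⊥`.
`clauseHolds v c` states that the assignment `v` satisfies the clause `c`. -/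
def clauseHolds (v : V → Prop) (c : Finset V × Option V) : Prop :=
  (∀ x ∈ c.1, v x) → (match c.2 with | some m => v m | none => False)

/-- The models of a set of clauses, viewed as a propositional formula. -/
def cnfModels (F : Set (Finset V × Option V)) (v : V → Prop) : Prop :=
  ∀ c ∈ F, clauseHolds v c

/-- `F ⊨ c`: every model of the clause set `F` satisfies the clause `c`. -/
def entailsClause (F : Set (Finset V × Option V))
    (c : Finset V × Option V) : Prop :=
  ∀ v : V → Prop, cnfModels F v → clauseHolds v c

/-- A set of clauses of the form `E → m` or `E → ⊥` with `E ⊆ I` and `m ∈ C`,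
where `I` and `C` are disjoint, entails `E → m` iff it contains `E' → m` or
`E' → ⊥` with `E' ⊆ E`, and entails `E → ⊥` iff it contains `E' → ⊥` with
`E' ⊆ E`. -/
theorem contained_body [Fintype V] [DecidableEq V]
    (I C : Finset V) (hdisj : Disjoint I C)
    (F : Set (Finset V × Option V))
    (hF : ∀ c ∈ F, c.1 ⊆ I ∧ ∀ m ∈ c.2, m ∈ C) :
    ∀ E ⊆ I, ∀ m ∈ C,
      (entailsClause F (E, some m) ↔
        ∃ E' ⊆ E, (E', some m) ∈ F ∨ (E', (none : Option V)) ∈ F) ∧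
      (entailsClause F (E, (none : Option V)) ↔
        ∃ E' ⊆ E, (E', (none : Option V)) ∈ F) := by
  have hd : ∀ x, x ∈ I → x ∈ C → False := fun x h1 h2 =>
    (Finset.disjoint_left.mp hdisj) h1 h2
  intro E hE m hm
  refine ⟨⟨?_, ?_⟩, ⟨?_, ?_⟩⟩
  · intro h
    by_contra hcon
    have key := h (fun x => x ∈ E ∨ (x ∈ C ∧ x ≠ m)) ?_ (fun x hx => Or.inl hx)
    · rcases key with key | key
      · exact hd m (hE key) hm
      · exact key.2 rfl
    · rintro ⟨E', o⟩ hc hbody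
      have hsub : E' ⊆ E := by
        intro x hx
        rcases hbody x hx with h1 | h1
        · exact h1
        · exact (hd x ((hF _ hc).1 hx) h1.1).elim
      cases o with
      | none => exact hcon ⟨E', hsub, Or.inr hc⟩
      | some k =>
        refine Or.inr ⟨(hF _ hc).2 k rfl, ?_⟩
        rintro rfl
        exact hcon ⟨E', hsub, Or.inl hc⟩
  · rintro ⟨E', hsub, hc | hc⟩ v hv hbody
    · exact hv _ hc (fun x hx => hbody x (hsub hx))
    · exact (hv _ hc (fun x hx => hbody x (hsub hx))).elim
  · intro h
    by_contra hcon
    refine h (fun x => x ∈ E ∨ x ∈ C) ?_ (fun x hx => Or.inl hx)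
    rintro ⟨E', o⟩ hc hbody
    have hsub : E' ⊆ E := by
      intro x hx
      rcases hbody x hx with h1 | h1
      · exact h1
      · exact (hd x ((hF _ hc).1 hx) h1).elim
    cases o with
    | none => exact hcon ⟨E', hsub, hc⟩
    | some k => exact Or.inr ((hF _ hc).2 k rfl)
  · rintro ⟨E', hsub, hc⟩ v hv hbody
    exact hv _ hc (fun x hx => hbody x (hsub hx))
end

section
/- Let S be a set of explanations over disjoint hypotheses I and manifestations C. Some propositional formula F satisfies abduct(F) = S if and only if abduct(G(S)) = S, where G(S) is the tentative-supporting formula of S. -/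
variable {V : Type*}

/-- A truth assignment `v` satisfies all variables of a finite set `E`. -/
def satAll (v : V → Prop) (E : Finset V) : Prop := ∀ x ∈ E, v x

/-- A propositional formula is identified with its set of models.
`F` supports the explanation `E ⇒ M` if `F ∪ E` is consistent and entails `M`. -/
def supports (F : (V → Prop) → Prop) (E M : Finset V) : Prop :=
  (∃ v, F v ∧ satAll v E) ∧ ∀ v, F v → satAll v E → satAll v M

/-- The set of explanations over hypotheses `I` and manifestations `C`
supported by the formula `F`. -/
def abduct (F : (V → Prop) → Prop) (I C : Finset V) :
    Set (Finset V × Finset V) :=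
  {p | p.1 ⊆ I ∧ p.2 ⊆ C ∧ p.2 ≠ ∅ ∧ supports F p.1 p.2}

/-- The tentative-supporting formula `G(S)` of a set `S` of explanations over
hypotheses `I` and manifestations `C`: a clause `E → m` for each
`E ⇒ {m} ∈ S`, and a clause `E → ⊥` for each pair `(E, m)` with `E ⊆ I`,
`m ∈ C`, `E ⇒ {m} ∉ S` such that `E' ⇒ {m} ∈ S` for some `E' ⊊ E`. -/
def GS (I C : Finset V) (S : Set (Finset V × Finset V)) :
    Set (Finset V × Option V) :=
  {c | (∃ E m, c = (E, some m) ∧ (E, ({m} : Finset V)) ∈ S) ∨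
       (∃ E, c = (E, (none : Option V)) ∧ E ⊆ I ∧
         ∃ m ∈ C, (E, ({m} : Finset V)) ∉ S ∧
           ∃ E' ⊂ E, (E', ({m} : Finset V)) ∈ S)}

/-- Some propositional formula `F` satisfies `abduct F = S` if and only if the
tentative-supporting formula `G(S)` does. -/
theorem gs_for_all [Fintype V] [DecidableEq V]
    (I C : Finset V) (hdisj : Disjoint I C)
    (S : Set (Finset V × Finset V))
    (hS : ∀ p ∈ S, p.1 ⊆ I ∧ p.2 ⊆ C ∧ p.2 ≠ ∅) :
    (∃ F : (V → Prop) → Prop, abduct F I C = S) ↔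
      abduct (cnfModels (GS I C S)) I C = S := by
  constructor
  swap
  · intro h
    exact ⟨_, h⟩
  rintro ⟨F, hF⟩
  have memS : ∀ E M, (E, M) ∈ S ↔ (E ⊆ I ∧ M ⊆ C ∧ M ≠ ∅ ∧ supports F E M) := by
    intro E M
    rw [← hF]
    exact Iff.rfl
  have hFG : ∀ v, F v → cnfModels (GS I C S) v := by
    rintro v hv c (⟨E, m, rfl, hm⟩ | ⟨E, rfl, hEI, m, hmC, hn, E', hE', hm⟩)
    · intro hE
      exact ((memS _ _).1 hm).2.2.2.2 v hv hE m (Finset.mem_singleton_self m)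
    · intro hE
      apply hn
      obtain ⟨-, h2, h3, h4⟩ := (memS _ _).1 hm
      exact (memS _ _).2 ⟨hEI, h2, h3, ⟨v, hv, hE⟩,
        fun w hw hwE => h4.2 w hw (fun x hx => hwE x (hE'.1 hx))⟩
  ext ⟨E, M⟩
  constructor
  · rintro ⟨hEI, hMC, hM, ⟨v, hv, hvE⟩, hent⟩
    dsimp only at hEI hMC hM hvE hent
    have key : ∀ m ∈ M, (E, ({m} : Finset V)) ∈ S := by
      intro m hm
      have hmod : cnfModels (GS I C S)
          (fun x => x ∈ E ∨ ∃ E' ⊆ E, (E', ({x} : Finset V)) ∈ S) := by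
        have sub : ∀ E1 : Finset V, E1 ⊆ I →
            (∀ x ∈ E1, x ∈ E ∨ ∃ E' ⊆ E, (E', ({x} : Finset V)) ∈ S) → E1 ⊆ E := by
          intro E1 h1 h x hx
          rcases h x hx with h | ⟨E', -, h'⟩
          · exact h
          · exact absurd ((hS _ h').2.1 (Finset.mem_singleton_self x))
              (Finset.disjoint_left.1 hdisj (h1 hx))
        rintro c (⟨E1, m1, rfl, hm1⟩ | ⟨E1, rfl, hEI1, m1, hmC, hn, E', hE', hm1⟩)
        · intro h
          exact Or.inr ⟨E1, sub E1 (hS _ hm1).1 h, hm1⟩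
        · intro h
          have hs := sub E1 hEI1 h
          exact hv (E1, none) (Or.inr ⟨E1, rfl, hEI1, m1, hmC, hn, E', hE', hm1⟩)
            (fun x hx => hvE x (hs hx))
      rcases hent _ hmod (fun x hx => Or.inl hx) m hm with h | ⟨E', hE', h'⟩
      · exact absurd (hMC hm) (Finset.disjoint_left.1 hdisj (hEI h))
      · by_contra hn
        have hne : E' ≠ E := by
          rintro rfl
          exact hn h'
        exact hv (E, none) (Or.inr ⟨E, rfl, hEI, m, hMC hm, hn, E',
          Finset.ssubset_iff_subset_ne.2 ⟨hE', hne⟩, h'⟩) hvE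
    obtain ⟨m0, hm0⟩ := Finset.nonempty_iff_ne_empty.2 hM
    refine (memS _ _).2 ⟨hEI, hMC, hM, ((memS _ _).1 (key m0 hm0)).2.2.2.1, ?_⟩
    intro w hw hwE m hm
    exact ((memS _ _).1 (key m hm)).2.2.2.2 w hw hwE m (Finset.mem_singleton_self m)
  · intro h
    obtain ⟨h1, h2, h3, ⟨v, hv, hvE⟩, h4⟩ := (memS _ _).1 h
    refine ⟨h1, h2, h3, ⟨v, hFG v hv, hvE⟩, ?_⟩
    intro w hw hwE m hm
    refine hw (E, some m) (Or.inl ⟨E, m, rfl, (memS _ _).2 ⟨h1, ?_, ?_, ⟨v, hv, hvE⟩, ?_⟩⟩) hwE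
    · exact Finset.singleton_subset_iff.2 (h2 hm)
    · exact Finset.singleton_ne_empty m
    · intro u hu huE x hx
      rw [Finset.mem_singleton.1 hx]
      exact h4 u hu huE m hm
end

section
/- A set S of explanations over disjoint hypotheses I and manifestations C is supported by some propositional formula (i.e., there exists F with abduct(F) = S) if and only if S satisfies both the conjunctive condition and overreaching monotony. -/
variable {V : Type*}

/-- The conjunctive condition for a set `S` of explanations over hypotheses
`I` and manifestations `C`. -/
def conjCond [DecidableEq V] (I C : Finset V)
    (S : Set (Finset V × Finset V)) : Prop :=
  ∀ E M₁ M₂ : Finset V, E ⊆ I → M₁ ⊆ C → M₂ ⊆ C → M₁ ≠ ∅ → M₂ ≠ ∅ →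
    (((E, M₁) ∈ S ∧ (E, M₂) ∈ S) ↔ (E, M₁ ∪ M₂) ∈ S)

/-- Overreaching monotony. -/
def overMonot (S : Set (Finset V × Finset V)) : Prop :=
  ∀ E E' E'' : Finset V, ∀ m m' : V,
    E ⊆ E' → E' ⊆ E'' →
    (E, ({m} : Finset V)) ∈ S → (E'', ({m'} : Finset V)) ∈ S →
    (E', ({m} : Finset V)) ∈ S

theorem mem_iff_singletons [DecidableEq V] (I C : Finset V)
    (S : Set (Finset V × Finset V)) (hc : conjCond I C S) (E : Finset V) (hE : E ⊆ I)
    (M : Finset V) (hM : M.Nonempty) :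
    M ⊆ C → ((E, M) ∈ S ↔ ∀ m ∈ M, (E, ({m} : Finset V)) ∈ S) := by
  induction hM using Finset.Nonempty.cons_induction with
  | singleton a => intro _; simp
  | cons a s has hs ih =>
    intro hC
    rw [Finset.cons_eq_insert] at *
    have h1 : ({a} : Finset V) ⊆ C := fun x hx => hC (by simp at hx; simp [hx])
    have h2 : s ⊆ C := fun x hx => hC (by simp [hx])
    rw [Finset.insert_eq, ← hc E {a} s hE h1 h2 (by simp) hs.ne_empty, ih h2]
    simp

/-- A set of explanations over disjoint hypotheses and manifestations is
supported by a formula if and only if it satisfies the conjunctive and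
overreaching monotony conditions. -/
theorem all_iff [Fintype V] [DecidableEq V]
    (I C : Finset V) (hdisj : Disjoint I C)
    (S : Set (Finset V × Finset V))
    (hS : ∀ p ∈ S, p.1 ⊆ I ∧ p.2 ⊆ C ∧ p.2 ≠ ∅) :
    (∃ F : (V → Prop) → Prop, abduct F I C = S) ↔
      conjCond I C S ∧ overMonot S := by
  constructor
  · rintro ⟨F, rfl⟩
    constructor
    · intro E M₁ M₂ hE h1 h2 n1 n2
      constructor
      · rintro ⟨⟨_, _, _, c, e1⟩, ⟨_, _, _, _, e2⟩⟩
        refine ⟨hE, Finset.union_subset h1 h2, ?_, c, ?_⟩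
        · intro h
          exact n1 (Finset.union_eq_empty.mp h).1
        · intro v hv hvE x hx
          rcases Finset.mem_union.mp hx with hx | hx
          · exact e1 v hv hvE x hx
          · exact e2 v hv hvE x hx
      · rintro ⟨_, _, _, c, e⟩
        exact ⟨⟨hE, h1, n1, c, fun v hv hvE x hx => e v hv hvE x (Finset.mem_union_left _ hx)⟩,
          ⟨hE, h2, n2, c, fun v hv hvE x hx => e v hv hvE x (Finset.mem_union_right _ hx)⟩⟩
    · rintro E E' E'' m m' h1 h2 ⟨_, b, n, _, e⟩ ⟨b', _, _, ⟨v, hv, hvE⟩, _⟩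
      exact ⟨h2.trans b', b, n, ⟨v, hv, fun x hx => hvE x (h2 hx)⟩,
        fun w hw hwE => e w hw (fun x hx => hwE x (h1 hx))⟩
  · rintro ⟨hc, ho⟩
    let F : (V → Prop) → Prop := fun v =>
      (∃ E'' m', (E'', ({m'} : Finset V)) ∈ S ∧ ∀ x ∈ I, v x → x ∈ E'') ∧
      (∀ m ∈ C, (v m ↔ ∃ E, satAll v E ∧ (E, ({m} : Finset V)) ∈ S))
    let w : Finset V → V → Prop := fun E x =>
      x ∈ E ∨ (x ∈ C ∧ ∃ E0, E0 ⊆ E ∧ (E0, ({x} : Finset V)) ∈ S)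
    have hIC : ∀ x ∈ I, x ∉ C := fun x hx hx' => Finset.disjoint_left.mp hdisj hx hx'
    have hwI : ∀ E, ∀ x ∈ I, (w E x ↔ x ∈ E) := by
      intro E x hx
      have := hIC x hx
      simp [w, this]
    have hwS : ∀ E E0, E0 ⊆ I → (satAll (w E) E0 ↔ E0 ⊆ E) := by
      intro E E0 h0
      exact ⟨fun h x hx => (hwI E x (h0 hx)).1 (h x hx),
        fun h x hx => (hwI E x (h0 hx)).2 (h hx)⟩
    have hwC : ∀ E, E ⊆ I → ∀ m ∈ C,
        (w E m ↔ ∃ E0, E0 ⊆ E ∧ (E0, ({m} : Finset V)) ∈ S) := by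
      intro E hE m hm
      have : m ∉ E := fun h => hIC m (hE h) hm
      simp [w, this, hm]
    have hwF : ∀ E E'' m', E ⊆ E'' → (E'', ({m'} : Finset V)) ∈ S → F (w E) := by
      intro E E'' m' h hs
      have hE : E ⊆ I := h.trans (hS _ hs).1
      refine ⟨⟨E'', m', hs, fun x hx hw => h ((hwI E x hx).1 hw)⟩, fun m hm => ?_⟩
      rw [hwC E hE m hm]
      exact ⟨fun ⟨E0, a, b⟩ => ⟨E0, (hwS E E0 (hS _ b).1).2 a, b⟩,
        fun ⟨E0, a, b⟩ => ⟨E0, (hwS E E0 (hS _ b).1).1 a, b⟩⟩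
    refine ⟨F, ?_⟩
    ext ⟨E, M⟩
    constructor
    · rintro ⟨hE, hM, hn, ⟨v, hv, hvE⟩, e⟩
      dsimp only at hE hM hn hvE e
      rw [mem_iff_singletons I C S hc E hE M (Finset.nonempty_iff_ne_empty.mpr hn) hM]
      intro m hm
      obtain ⟨⟨E'', m', hs, hx⟩, _⟩ := hv
      have hEE : E ⊆ E'' := fun x h => hx x (hE h) (hvE x h)
      have h1 := e (w E) (hwF E E'' m' hEE hs) ((hwS E E hE).2 subset_rfl) m hm
      obtain ⟨E0, a, b⟩ := (hwC E hE m (hM hm)).1 h1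
      exact ho E0 E E'' m m' a hEE b hs
    · intro h
      obtain ⟨hE, hM, hn⟩ := hS _ h
      dsimp only at hE hM hn
      have hne := Finset.nonempty_iff_ne_empty.mpr hn
      have hs := (mem_iff_singletons I C S hc E hE M hne hM).1 h
      obtain ⟨m0, hm0⟩ := hne
      refine ⟨hE, hM, hn, ⟨w E, hwF E E m0 subset_rfl (hs m0 hm0), (hwS E E hE).2 subset_rfl⟩, ?_⟩
      intro v hv hvE m hm
      exact (hv.2 m (hM hm)).2 ⟨E, hvE, hs m hm⟩
end

section
/- Abductive forgetting may not be expressible by any propositional formula: for F = (a∧b→x) ∧ (a∧c→y) ∧ (b∧c→⊥), hypotheses I = {a,b,c}, manifestations C = {x,y}, and remembered variables R = {a,x,y}, the set summarize(⟨F,I,C⟩,R) equals {a ⇒ {x}, a ⇒ {y}} and there is no propositional formula G with abduct(⟨G, I∩R, C∩R⟩) = summarize(⟨F,I,C⟩,R). -/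
variable {V : Type*}

/-- Focusing the abduction frame `⟨F, I, C⟩` on the variables `R`. -/
def focus [DecidableEq V] (F : (V → Prop) → Prop) (I C R : Finset V) :
    Set (Finset V × Finset V) :=
  {p | p.1 ⊆ I ∩ R ∧ p.2 ⊆ C ∩ R ∧ p.2 ≠ ∅ ∧
    ∃ E' ⊆ I \ R, ∃ M' ⊆ C \ R, (p.1 ∪ E', p.2 ∪ M') ∈ abduct F I C}

/-- Summarizing the abduction frame `⟨F, I, C⟩` on the variables `R`. -/
def summarize [DecidableEq V] (F : (V → Prop) → Prop) (I C R : Finset V) :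
    Set (Finset V × Finset V) :=
  {p | p.1 ⊆ I ∩ R ∧ p.2 ⊆ C ∩ R ∧
    ∃ E' ⊆ I \ R, (p.1 ∪ E', p.2) ∈ abduct F I C}

/-- Abductive forgetting may not be expressible by any propositional formula.
With variables `a = 0`, `b = 1`, `c = 2`, `x = 3`, `y = 4`, the formula
`F = (a∧b→x) ∧ (a∧c→y) ∧ (b∧c→⊥)`, hypotheses `I = {a,b,c}`, manifestations
`C = {x,y}` and remembered variables `R = {a,x,y}`: summarizing gives exactly
`{a ⇒ {x}, a ⇒ {y}}`, and no formula `G` supports exactly this set of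
explanations over `I ∩ R` and `C ∩ R`. -/
theorem forgetting_not_expressible :
    summarize (fun v : Fin 5 → Prop =>
        ((v 0 ∧ v 1) → v 3) ∧ ((v 0 ∧ v 2) → v 4) ∧ ¬(v 1 ∧ v 2))
      ({0, 1, 2} : Finset (Fin 5)) ({3, 4} : Finset (Fin 5))
      ({0, 3, 4} : Finset (Fin 5)) =
      ({(({0} : Finset (Fin 5)), ({3} : Finset (Fin 5))),
        (({0} : Finset (Fin 5)), ({4} : Finset (Fin 5)))} :
        Set (Finset (Fin 5) × Finset (Fin 5))) ∧
    ¬ ∃ G : (Fin 5 → Prop) → Prop,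
      abduct G (({0, 1, 2} : Finset (Fin 5)) ∩ ({0, 3, 4} : Finset (Fin 5)))
          (({3, 4} : Finset (Fin 5)) ∩ ({0, 3, 4} : Finset (Fin 5))) =
        summarize (fun v : Fin 5 → Prop =>
            ((v 0 ∧ v 1) → v 3) ∧ ((v 0 ∧ v 2) → v 4) ∧ ¬(v 1 ∧ v 2))
          ({0, 1, 2} : Finset (Fin 5)) ({3, 4} : Finset (Fin 5))
          ({0, 3, 4} : Finset (Fin 5)) := by
  have key : summarize (fun v : Fin 5 → Prop =>
        ((v 0 ∧ v 1) → v 3) ∧ ((v 0 ∧ v 2) → v 4) ∧ ¬(v 1 ∧ v 2))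
      ({0, 1, 2} : Finset (Fin 5)) ({3, 4} : Finset (Fin 5))
      ({0, 3, 4} : Finset (Fin 5)) =
      ({(({0} : Finset (Fin 5)), ({3} : Finset (Fin 5))),
        (({0} : Finset (Fin 5)), ({4} : Finset (Fin 5)))} :
        Set (Finset (Fin 5) × Finset (Fin 5))) := by
    ext ⟨E, M⟩
    simp only [summarize, abduct, supports, satAll, Set.mem_ofPred_eq, Set.mem_insert_iff,
      Set.mem_singleton_iff, Prod.mk.injEq]
    constructor
    · rintro ⟨hE, hM, E', hE', hEE, -, hne, ⟨v, ⟨-, -, hv⟩, hvE⟩, hent⟩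
      have hM34 : ∀ i ∈ M, i = 3 ∨ i = 4 := by
        intro i hi
        have := hM hi
        clear hi; revert i; decide
      have hE0 : ∀ i ∈ E, i = 0 := by
        intro i hi
        have := hE hi
        clear hi; revert i; decide
      have hE12 : ∀ i ∈ E', i = 1 ∨ i = 2 := by
        intro i hi
        have := hE' hi
        clear hi; revert i; decide
      have h0 : 0 ∈ E := by
        by_contra h0
        apply hne
        rw [Finset.eq_empty_iff_forall_notMem]
        intro j hj
        have := hent (fun i => v i ∧ (i = 1 ∨ i = 2)) (by simp; exact fun a b => hv ⟨a, b⟩)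
          (by
            intro i hi
            refine ⟨hvE i hi, ?_⟩
            rcases Finset.mem_union.1 hi with h | h
            · exact absurd (hE0 i h ▸ h) h0
            · exact hE12 i h) j hj
        rcases hM34 j hj with rfl | rfl <;> simp at this
      have hE1 : E = {0} := by
        ext i
        simp only [Finset.mem_singleton]
        exact ⟨hE0 i, fun h => h ▸ h0⟩
      have hnot : ¬ (3 ∈ M ∧ 4 ∈ M) := by
        rintro ⟨h3, h4⟩
        by_cases h1 : v 1
        · have h2 : ¬ v 2 := fun h => hv ⟨h1, h⟩
          have := hent (fun i => i = 0 ∨ i = 1 ∨ i = 3) (by simp)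
            (by
              intro i hi
              rcases Finset.mem_union.1 hi with h | h
              · exact Or.inl (hE0 i h)
              · rcases hE12 i h with rfl | rfl
                · simp
                · exact absurd (hvE _ hi) h2) 4 h4
          simp at this
        · have := hent (fun i => i = 0 ∨ i = 2 ∨ i = 4) (by simp)
            (by
              intro i hi
              rcases Finset.mem_union.1 hi with h | h
              · exact Or.inl (hE0 i h)
              · rcases hE12 i h with rfl | rfl
                · exact absurd (hvE _ hi) h1
                · simp) 3 h3
          simp at this
      clear hent hvE hv hEE hM hE hE'
      have hfin : M = {3} ∨ M = {4} := by
        revert M; decide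
      rcases hfin with h | h
      · exact Or.inl ⟨hE1, h⟩
      · exact Or.inr ⟨hE1, h⟩
    · rintro (⟨rfl, rfl⟩ | ⟨rfl, rfl⟩)
      · refine ⟨by decide, by decide, {1}, by decide, by decide, by decide, by decide,
          ⟨fun i => i = 0 ∨ i = 1 ∨ i = 3, by simp, by simp⟩, ?_⟩
        rintro w ⟨h, -⟩ hw i hi
        rw [Finset.mem_singleton.1 hi]
        exact h ⟨hw 0 (by decide), hw 1 (by decide)⟩
      · refine ⟨by decide, by decide, {2}, by decide, by decide, by decide, by decide,
          ⟨fun i => i = 0 ∨ i = 2 ∨ i = 4, by simp, by simp⟩, ?_⟩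
        rintro w ⟨-, h, -⟩ hw i hi
        rw [Finset.mem_singleton.1 hi]
        exact h ⟨hw 0 (by decide), hw 2 (by decide)⟩
  refine ⟨key, ?_⟩
  rintro ⟨G, hG⟩
  rw [key] at hG
  have a3 := hG.symm.subset (Or.inl rfl)
  have a4 := hG.symm.subset (Or.inr rfl)
  obtain ⟨h1, -, -, hc, h3⟩ := a3
  obtain ⟨-, -, -, -, h4⟩ := a4
  have hm : (({0} : Finset (Fin 5)), ({3, 4} : Finset (Fin 5))) ∈
      ({(({0} : Finset (Fin 5)), ({3} : Finset (Fin 5))),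
        (({0} : Finset (Fin 5)), ({4} : Finset (Fin 5)))} :
        Set (Finset (Fin 5) × Finset (Fin 5))) := hG.subset
    ⟨h1, by decide, by simp, hc, by
      intro v hv hs i hi
      rcases Finset.mem_insert.1 hi with rfl | hi
      · exact h3 v hv hs _ (by simp)
      · exact h4 v hv hs _ hi⟩
  revert hm
  simp only [Set.mem_insert_iff, Set.mem_singleton_iff, Prod.mk.injEq]
  decide
end

section
/- Let S be a set of explanations over disjoint hypotheses I and manifestations C, and let G(S) be its tentative-supporting minimal-abduction formula. If G(S) does not minimally support S, then either (1) S contains both E ⇒ M and E' ⇒ M for some E' < E; or (2) there exist E, E' ⊆ E and M such that S contains E ⇒ M and G(S) contains the clause E' → ⊥. -/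
variable {V : Type*}

/-- `F` minimally supports the explanation `E ⇒ M` (with respect to the
strict order `lt` on sets of hypotheses): `F` supports `E ⇒ M` and supports
no explanation `E' ⇒ M` with `E' < E`. -/
def minSupports (F : (V → Prop) → Prop) (I : Finset V)
    (lt : Finset V → Finset V → Prop) (E M : Finset V) : Prop :=
  supports F E M ∧ ∀ E' ⊆ I, lt E' E → ¬ supports F E' M

/-- `F` minimally supports the set `S` of explanations: `S` is exactly the
set of explanations over `I` and `C` minimally supported by `F`. -/
def minSupportsSet (F : (V → Prop) → Prop) (I C : Finset V)
    (lt : Finset V → Finset V → Prop)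
    (S : Set (Finset V × Finset V)) : Prop :=
  ∀ E M : Finset V,
    (E, M) ∈ S ↔ (E ⊆ I ∧ M ⊆ C ∧ M ≠ ∅ ∧ minSupports F I lt E M)

/-- The tentative-supporting minimal-abduction formula `G(S)`, as a set of
clauses: a clause `E → m` for each `E ⇒ M ∈ S` and `m ∈ M`, and a clause
`E → ⊥` for each pair `(E, M)` with `E ⊆ I`, `∅ ≠ M ⊆ C`, `E ⇒ M ∉ S` such
that (a) for every `m ∈ M` there are `E' ⊆ E` and `M'` with `m ∈ M'` and
`E' ⇒ M' ∈ S`, and (b) for every `E' < E`, `E' ⇒ M ∉ S`. -/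
def GSmin (I C : Finset V) (lt : Finset V → Finset V → Prop)
    (S : Set (Finset V × Finset V)) : Set (Finset V × Option V) :=
  {cl | (∃ E M m, cl = (E, some m) ∧ (E, M) ∈ S ∧ m ∈ M) ∨
        (∃ E, cl = (E, (none : Option V)) ∧ E ⊆ I ∧
          ∃ M : Finset V, M ⊆ C ∧ M ≠ ∅ ∧ (E, M) ∉ S ∧
            (∀ m ∈ M, ∃ E' M' : Finset V, E' ⊆ E ∧ m ∈ M' ∧ (E', M') ∈ S) ∧
            (∀ E', lt E' E → (E', M) ∉ S))}

/-- If `G(S)` does not minimally support `S`, then either `S` contains both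
`E ⇒ M` and `E' ⇒ M` for some `E' < E`, or there are `E`, `E' ⊆ E` and `M`
such that `S` contains `E ⇒ M` and `G(S)` contains the clause `E' → ⊥`. -/
theorem gs_e_bot_minimal [Fintype V] [DecidableEq V]
    (I C : Finset V) (hdisj : Disjoint I C)
    (lt : Finset V → Finset V → Prop)
    (hlt_irrefl : ∀ A : Finset V, ¬ lt A A)
    (hlt_trans : ∀ A B D : Finset V, lt A B → lt B D → lt A D)
    (hlt_ssubset : ∀ A B : Finset V, A ⊂ B → lt A B)
    (S : Set (Finset V × Finset V))
    (hS : ∀ p ∈ S, p.1 ⊆ I ∧ p.2 ⊆ C ∧ p.2 ≠ ∅)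
    (h : ¬ minSupportsSet (cnfModels (GSmin I C lt S)) I C lt S) :
    (∃ E E' M : Finset V, (E, M) ∈ S ∧ (E', M) ∈ S ∧ lt E' E) ∨
    (∃ E E' M : Finset V, E' ⊆ E ∧ (E, M) ∈ S ∧
      (E', (none : Option V)) ∈ GSmin I C lt S) := by
  classical
  by_contra hcon
  rw [not_or] at hcon
  obtain ⟨h1, h2⟩ := hcon
  apply h
  -- canonical model
  have model : ∀ E ⊆ I, (∀ E' ⊆ E, (E', (none : Option V)) ∉ GSmin I C lt S) →
      cnfModels (GSmin I C lt S)
        (fun x => x ∈ E ∨ ∃ E' M' : Finset V, E' ⊆ E ∧ x ∈ M' ∧ (E', M') ∈ S) := by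
    intro E hE hb c hc
    have key : ∀ A : Finset V, A ⊆ I → (∀ x ∈ A, (x ∈ E ∨
        ∃ E' M' : Finset V, E' ⊆ E ∧ x ∈ M' ∧ (E', M') ∈ S)) → A ⊆ E := by
      intro A hA hx x hxA
      rcases hx x hxA with h' | ⟨E', M', _, hm, hs⟩
      · exact h'
      · exact absurd ((hS _ hs).2.1 hm) (Finset.disjoint_left.mp hdisj (hA hxA))
    have hc0 := hc
    rcases hc with ⟨A, M, m, rfl, hs, hm⟩ | ⟨A, rfl, hA, _⟩
    · intro hx
      exact Or.inr ⟨A, M, key A (hS _ hs).1 hx, hm, hs⟩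
    · intro hx
      exact hb A (key A hA hx) hc0
  have lemA : ∀ E M : Finset V, E ⊆ I → M ⊆ C → M ≠ ∅ →
      supports (cnfModels (GSmin I C lt S)) E M →
      (E, M) ∈ S ∨ ∃ E', lt E' E ∧ (E', M) ∈ S := by
    intro E M hE hM hne hsup
    obtain ⟨⟨v, hv, hvE⟩, hent⟩ := hsup
    have hb : ∀ E' ⊆ E, (E', (none : Option V)) ∉ GSmin I C lt S :=
      fun E' hE' hmem => hv _ hmem (fun x hx => hvE x (hE' hx))
    by_contra hn
    rw [not_or] at hn
    refine hb E (Finset.Subset.refl E) (Or.inr ⟨E, rfl, hE, M, hM, hne, hn.1, ?_,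
      fun E' hl hs => hn.2 ⟨E', hl, hs⟩⟩)
    intro m hm
    rcases hent _ (model E hE hb) (fun x hx => Or.inl hx) m hm with h' | h'
    · exact absurd (hM hm) (Finset.disjoint_left.mp hdisj (hE h'))
    · exact h'
  have lemB : ∀ E M : Finset V, (E, M) ∈ S →
      supports (cnfModels (GSmin I C lt S)) E M := by
    intro E M hs
    refine ⟨⟨_, model E (hS _ hs).1 (fun E' hE' hmem => h2 ⟨E, E', M, hE', hs, hmem⟩),
      fun x hx => Or.inl hx⟩, ?_⟩
    intro v hv hvE m hm
    exact hv (E, some m) (Or.inl ⟨E, M, m, rfl, hs, hm⟩) hvE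
  intro E M
  constructor
  · intro hs
    obtain ⟨hE, hM, hne⟩ := hS _ hs
    refine ⟨hE, hM, hne, lemB E M hs, ?_⟩
    intro E' hE' hl hsup
    rcases lemA E' M hE' hM hne hsup with h' | ⟨E'', hl', h'⟩
    · exact h1 ⟨E, E', M, hs, h', hl⟩
    · exact h1 ⟨E, E'', M, hs, h', hlt_trans _ _ _ hl' hl⟩
  · rintro ⟨hE, hM, hne, hsup, hmin⟩
    rcases lemA E M hE hM hne hsup with h' | ⟨E', hl, h'⟩
    · exact h'
    · exact absurd (lemB E' M h') (hmin E' (hS _ h').1 hl)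
end

section
/- Let S be a set of explanations over disjoint hypotheses I and manifestations C, and let G(S) be its tentative-supporting minimal-abduction formula. If a formula F minimally supports S, then F entails every clause E → ⊥ of G(S). -/
variable {V : Type*}

/-- If `F` minimally supports `S`, then `F` entails every clause `E → ⊥` of
`G(S)`. -/
theorem minimal_entailed [Fintype V] [DecidableEq V]
    (I C : Finset V) (hdisj : Disjoint I C)
    (lt : Finset V → Finset V → Prop)
    (hlt_irrefl : ∀ A : Finset V, ¬ lt A A)
    (hlt_trans : ∀ A B D : Finset V, lt A B → lt B D → lt A D)
    (hlt_ssubset : ∀ A B : Finset V, A ⊂ B → lt A B)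
    (S : Set (Finset V × Finset V))
    (hS : ∀ p ∈ S, p.1 ⊆ I ∧ p.2 ⊆ C ∧ p.2 ≠ ∅)
    (F : (V → Prop) → Prop) (hF : minSupportsSet F I C lt S) :
    ∀ E : Finset V, (E, (none : Option V)) ∈ GSmin I C lt S →
      ∀ v : V → Prop, F v → ¬ satAll v E := by
  intro E hE v hv hvE
  rcases hE with ⟨_, _, _, h, _⟩ | ⟨E₀, h, hEI, M, hMC, hM0, hMS, ha, hb⟩
  · simp at h
  obtain rfl : E = E₀ := by simpa using h
  have hsup : supports F E M := by
    refine ⟨⟨v, hv, hvE⟩, fun w hw hwE m hm => ?_⟩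
    obtain ⟨E', M', hE', hm', hS'⟩ := ha m hm
    exact ((hF E' M').1 hS').2.2.2.1.2 w hw (fun x hx => hwE x (hE' hx)) m hm'
  haveI : IsTrans (Finset V) lt := ⟨hlt_trans⟩
  haveI : Std.Irrefl lt := ⟨hlt_irrefl⟩
  have wf : WellFounded lt := Finite.wellFounded_of_trans_of_irrefl lt
  obtain ⟨A, ⟨hAI, hAs, hAE⟩, hmin⟩ := wf.has_min
    {A | A ⊆ I ∧ supports F A M ∧ (A = E ∨ lt A E)} ⟨E, hEI, hsup, Or.inl rfl⟩
  have hAS : (A, M) ∈ S := by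
    refine (hF A M).2 ⟨hAI, hMC, hM0, hAs, fun B hBI hBA hBs => ?_⟩
    refine hmin B ⟨hBI, hBs, Or.inr ?_⟩ hBA
    rcases hAE with rfl | hAE
    · exact hBA
    · exact hlt_trans _ _ _ hBA hAE
  rcases hAE with rfl | hAE
  · exact hMS hAS
  · exact hb A hAE hAS
end

section
/- Let S be a set of explanations over disjoint hypotheses I and manifestations C, and let G(S) be its tentative-supporting minimal-abduction formula. A formula minimally supporting S exists if and only if G(S) minimally supports S. -/
variable {V : Type*}

theorem gs_key [DecidableEq V]
    (I C : Finset V) (hdisj : Disjoint I C)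
    (lt : Finset V → Finset V → Prop)
    (S : Set (Finset V × Finset V))
    (hS : ∀ p ∈ S, p.1 ⊆ I ∧ p.2 ⊆ C ∧ p.2 ≠ ∅)
    (E M : Finset V) (hE : E ⊆ I) (hM : M ⊆ C) (hM0 : M ≠ ∅)
    (hs : supports (cnfModels (GSmin I C lt S)) E M) :
    (E, M) ∈ S ∨ ∃ E', lt E' E ∧ (E', M) ∈ S := by
  by_contra hcon
  push Not at hcon
  obtain ⟨hn, hb⟩ := hcon
  obtain ⟨⟨w, hw, hwE⟩, hent⟩ := hs
  let v : V → Prop := fun x => x ∈ E ∨ ∃ E' M' : Finset V, E' ⊆ E ∧ x ∈ M' ∧ (E', M') ∈ S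
  have hvI : ∀ A : Finset V, A ⊆ I → (∀ x ∈ A, v x) → A ⊆ E := by
    intro A hA hv x hx
    rcases hv x hx with h | ⟨E', M', _, h2, h3⟩
    · exact h
    · exact absurd ((hS _ h3).2.1 h2) (Finset.disjoint_left.mp hdisj (hA hx))
  have hv : cnfModels (GSmin I C lt S) v := by
    rintro c hc
    rcases id hc with ⟨A, N, m, rfl, hAN, hm⟩ | ⟨A, rfl, hA, -⟩
    · intro h
      exact Or.inr ⟨A, N, hvI A (hS _ hAN).1 h, hm, hAN⟩
    · intro h
      exact hw _ hc (fun x hx => hwE x (hvI A hA h hx))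
  have ha := hent v hv (fun x hx => Or.inl hx)
  refine hw (E, none) (Or.inr ⟨E, rfl, hE, M, hM, hM0, hn, ?_, hb⟩) hwE
  intro m hm
  rcases ha m hm with h | h
  · exact absurd (hM hm) (Finset.disjoint_left.mp hdisj (hE h))
  · exact h

theorem gs_models [Fintype V] [DecidableEq V]
    (I C : Finset V)
    (lt : Finset V → Finset V → Prop)
    (hlt_irrefl : ∀ A : Finset V, ¬ lt A A)
    (hlt_trans : ∀ A B D : Finset V, lt A B → lt B D → lt A D)
    (S : Set (Finset V × Finset V))
    (F : (V → Prop) → Prop) (hF : minSupportsSet F I C lt S)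
    (v : V → Prop) (hv : F v) : cnfModels (GSmin I C lt S) v := by
  have wf : WellFounded lt := by
    haveI : IsTrans (Finset V) lt := ⟨hlt_trans⟩
    haveI : Std.Irrefl lt := ⟨hlt_irrefl⟩
    exact Finite.wellFounded_of_trans_of_irrefl lt
  rintro c (⟨A, N, m, rfl, hAN, hm⟩ | ⟨A, rfl, hA, N, hN, hN0, hn, ha, hb⟩)
  · intro h
    exact ((hF A N).1 hAN).2.2.2.1.2 v hv h m hm
  · intro h
    have hsup : supports F A N := by
      refine ⟨⟨v, hv, h⟩, fun u hu huA m hm => ?_⟩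
      obtain ⟨E', M', h1, h2, h3⟩ := ha m hm
      exact ((hF E' M').1 h3).2.2.2.1.2 u hu (fun x hx => huA x (h1 hx)) m h2
    have key : ∀ B : Finset V, B ⊆ I → supports F B N → (B = A ∨ lt B A) → False := by
      intro B
      induction B using wf.induction with
      | _ B ih =>
        intro hB hs hle
        by_cases hBS : (B, N) ∈ S
        · rcases hle with rfl | hl
          · exact hn hBS
          · exact hb B hl hBS
        · apply hBS
          refine (hF B N).2 ⟨hB, hN, hN0, hs, fun D hD hl hsD => ih D hl hD hsD (Or.inr ?_)⟩
          rcases hle with rfl | h2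
          · exact hl
          · exact hlt_trans _ _ _ hl h2
    exact key A hA hsup (Or.inl rfl)

/-- A formula minimally supporting `S` exists if and only if `G(S)` minimally
supports `S`. -/
theorem minimal_gs_exists [Fintype V] [DecidableEq V]
    (I C : Finset V) (hdisj : Disjoint I C)
    (lt : Finset V → Finset V → Prop)
    (hlt_irrefl : ∀ A : Finset V, ¬ lt A A)
    (hlt_trans : ∀ A B D : Finset V, lt A B → lt B D → lt A D)
    (hlt_ssubset : ∀ A B : Finset V, A ⊂ B → lt A B)
    (S : Set (Finset V × Finset V))
    (hS : ∀ p ∈ S, p.1 ⊆ I ∧ p.2 ⊆ C ∧ p.2 ≠ ∅) :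
    (∃ F : (V → Prop) → Prop, minSupportsSet F I C lt S) ↔
      minSupportsSet (cnfModels (GSmin I C lt S)) I C lt S := by
  refine ⟨?_, fun h => ⟨_, h⟩⟩
  rintro ⟨F, hF⟩
  have hG := gs_models I C lt hlt_irrefl hlt_trans S F hF
  have hsupp : ∀ E M, (E, M) ∈ S → supports (cnfModels (GSmin I C lt S)) E M := by
    intro E M h
    obtain ⟨⟨v, hv, hvE⟩, -⟩ := ((hF E M).1 h).2.2.2.1
    exact ⟨⟨v, hG v hv, hvE⟩, fun u hu huE m hm =>
      hu (E, some m) (Or.inl ⟨E, M, m, rfl, h, hm⟩) huE⟩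
  intro E M
  constructor
  · intro h
    obtain ⟨h1, h2, h3⟩ := hS _ h
    refine ⟨h1, h2, h3, hsupp E M h, fun E' hE' hl hs => ?_⟩
    have hmin := ((hF E M).1 h).2.2.2.2
    rcases gs_key I C hdisj lt S hS E' M hE' h2 h3 hs with h4 | ⟨E2, hl2, h4⟩
    · exact hmin E' hE' hl ((hF _ _).1 h4).2.2.2.1
    · exact hmin E2 (hS _ h4).1 (hlt_trans _ _ _ hl2 hl) ((hF _ _).1 h4).2.2.2.1
  · rintro ⟨h1, h2, h3, hs, hmin⟩
    rcases gs_key I C hdisj lt S hS E M h1 h2 h3 hs with h4 | ⟨E2, hl2, h4⟩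
    · exact h4
    · exact absurd (hsupp _ _ h4) (hmin E2 (hS _ h4).1 hl2)
end

section
/- For every propositional formula F over disjoint hypotheses I and manifestations C, the set of explanations minimally supported by F satisfies the inconsistency condition. -/
variable {V : Type*}

/-- The set of explanations over hypotheses `I` and manifestations `C`
minimally supported by the formula `F`. -/
def minAbduct (F : (V → Prop) → Prop) (I C : Finset V)
    (lt : Finset V → Finset V → Prop) : Set (Finset V × Finset V) :=
  {p | p.1 ⊆ I ∧ p.2 ⊆ C ∧ p.2 ≠ ∅ ∧ minSupports F I lt p.1 p.2}

/-- The inconsistency condition: there are no `E`, `E' ⊆ E`, `M` and `M'`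
(with `E' ⇒ M'` an explanation over `I` and `C`) such that `E ⇒ M ∈ S`,
`E' ⇒ M' ∉ S`, every `m ∈ M'` satisfies `m ∈ M''` and `E'' ⇒ M'' ∈ S` for
some `E'' ⊆ E'` and `M''`, and `E'' ⇒ M' ∉ S` for every `E'' < E'`. -/
def inconsCond (C : Finset V) (lt : Finset V → Finset V → Prop)
    (S : Set (Finset V × Finset V)) : Prop :=
  ¬ ∃ E E' M M' : Finset V, E' ⊆ E ∧ M' ⊆ C ∧ M' ≠ ∅ ∧
      (E, M) ∈ S ∧ (E', M') ∉ S ∧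
      (∀ m ∈ M', ∃ E'' M'' : Finset V, E'' ⊆ E' ∧ m ∈ M'' ∧ (E'', M'') ∈ S) ∧
      (∀ E'', lt E'' E' → (E'', M') ∉ S)

/-- The set of explanations minimally supported by an arbitrary formula
satisfies the inconsistency condition. -/
theorem minAbduct_satisfies_inconsCond [Fintype V] [DecidableEq V]
    (F : (V → Prop) → Prop) (I C : Finset V) (hdisj : Disjoint I C)
    (lt : Finset V → Finset V → Prop)
    (hlt_irrefl : ∀ A : Finset V, ¬ lt A A)
    (hlt_trans : ∀ A B D : Finset V, lt A B → lt B D → lt A D)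
    (hlt_ssubset : ∀ A B : Finset V, A ⊂ B → lt A B) :
    inconsCond C lt (minAbduct F I C lt) := by
  rintro ⟨E, E', M, M', hE, hC, hne, ⟨hEI, -, -, ⟨⟨v, hv, hvE⟩, -⟩, -⟩, hnot, hall, hmin⟩
  have hsup : supports F E' M' := by
    refine ⟨⟨v, hv, fun x hx => hvE x (hE hx)⟩, fun w hw hwE m hm => ?_⟩
    obtain ⟨E2, M2, h2, hm2, -, -, -, ⟨-, h3⟩, -⟩ := hall m hm
    exact h3 w hw (fun x hx => hwE x (h2 hx)) m hm2
  have : IsTrans (Finset V) lt := ⟨hlt_trans⟩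
  have : Std.Irrefl lt := ⟨hlt_irrefl⟩
  have hwf : WellFounded lt := Finite.wellFounded_of_trans_of_irrefl lt
  have hE'I : E' ⊆ I := fun x hx => hEI (hE hx)
  refine hnot ⟨hE'I, hC, hne, hsup, fun A hA hAlt hAs => ?_⟩
  obtain ⟨B, ⟨hBI, hBlt, hBs⟩, hB⟩ := hwf.has_min
    {B | B ⊆ I ∧ lt B E' ∧ supports F B M'} ⟨A, hA, hAlt, hAs⟩
  exact hmin B hBlt ⟨hBI, hC, hne, hBs, fun D hD hDB hDs =>
    hB D ⟨hD, hlt_trans _ _ _ hDB hBlt, hDs⟩ hDB⟩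
end

section
/- A set S of explanations over disjoint hypotheses I and manifestations C is minimally supported by some propositional formula if and only if S satisfies both the minority condition and the inconsistency condition. -/
variable {V : Type*}

/-- The minority condition: `S` does not contain both `E ⇒ M` and `E' ⇒ M`
with `E' < E`. -/
def minorityCond (lt : Finset V → Finset V → Prop)
    (S : Set (Finset V × Finset V)) : Prop :=
  ¬ ∃ E E' M : Finset V, (E, M) ∈ S ∧ (E', M) ∈ S ∧ lt E' E

/-- A set of explanations over disjoint hypotheses and manifestations is
minimally supported by some formula if and only if it satisfies the minority
condition and the inconsistency condition. -/
theorem minimally_supported_iff [Fintype V] [DecidableEq V]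
    (I C : Finset V) (hdisj : Disjoint I C)
    (lt : Finset V → Finset V → Prop)
    (hlt_irrefl : ∀ A : Finset V, ¬ lt A A)
    (hlt_trans : ∀ A B D : Finset V, lt A B → lt B D → lt A D)
    (hlt_ssubset : ∀ A B : Finset V, A ⊂ B → lt A B)
    (S : Set (Finset V × Finset V))
    (hS : ∀ p ∈ S, p.1 ⊆ I ∧ p.2 ⊆ C ∧ p.2 ≠ ∅) :
    (∃ F : (V → Prop) → Prop, minSupportsSet F I C lt S) ↔
      minorityCond lt S ∧ inconsCond C lt S := by
  have hsat : ∀ (v : V → Prop) (A B : Finset V), A ⊆ B → satAll v B → satAll v A :=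
    fun v A B h hB x hx => hB x (h hx)
  have hdis : ∀ x, x ∈ I → x ∈ C → False := fun x h1 h2 => Finset.disjoint_left.mp hdisj h1 h2
  have hwf : WellFounded lt := by
    haveI : IsTrans (Finset V) lt := ⟨hlt_trans⟩
    haveI : Std.Irrefl lt := ⟨hlt_irrefl⟩
    exact Finite.wellFounded_of_trans_of_irrefl lt
  constructor
  · rintro ⟨F, hF⟩
    constructor
    · rintro ⟨E, E', M, h1, h2, h3⟩
      have a := (hF _ _).1 h1
      have b := (hF _ _).1 h2
      exact a.2.2.2.2 E' b.1 h3 b.2.2.2.1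
    · rintro ⟨E, E', M, M', hE, hM', hne, h1, h2, h3, h4⟩
      have a := (hF _ _).1 h1
      have hE'I : E' ⊆ I := hE.trans a.1
      have hsup : supports F E' M' := by
        obtain ⟨v, hv, hvE⟩ := a.2.2.2.1.1
        refine ⟨⟨v, hv, hsat v _ _ hE hvE⟩, ?_⟩
        intro w hw hwE m hm
        obtain ⟨E'', M'', hs, hm'', hS''⟩ := h3 m hm
        have b := (hF _ _).1 hS''
        exact b.2.2.2.1.2 w hw (hsat w _ _ hs hwE) m hm''
      obtain ⟨A, ⟨hA1, hA2, hA3⟩, hAmin⟩ := hwf.has_min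
        {A | A ⊆ I ∧ supports F A M' ∧ (A = E' ∨ lt A E')} ⟨E', hE'I, hsup, Or.inl rfl⟩
      have hAS : (A, M') ∈ S := by
        refine (hF _ _).2 ⟨hA1, hM', hne, hA2, ?_⟩
        intro B hB hlt hBs
        refine hAmin B ⟨hB, hBs, Or.inr ?_⟩ hlt
        rcases hA3 with rfl | h
        · exact hlt
        · exact hlt_trans _ _ _ hlt h
      rcases hA3 with rfl | h
      · exact h2 hAS
      · exact h4 A h hAS
  · rintro ⟨hmin, hinc⟩
    let Neg : Finset V → Prop := fun E => ∃ M : Finset V, M ⊆ C ∧ M ≠ ∅ ∧ (E, M) ∉ S ∧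
            (∀ m ∈ M, ∃ E' M' : Finset V, E' ⊆ E ∧ m ∈ M' ∧ (E', M') ∈ S) ∧
            (∀ E', lt E' E → (E', M) ∉ S)
    let D : Finset V → V → Prop := fun E m => ∃ E' M' : Finset V, E' ⊆ E ∧ m ∈ M' ∧ (E', M') ∈ S
    let F : (V → Prop) → Prop := fun v =>
      (∀ E M, (E, M) ∈ S → satAll v E → satAll v M) ∧ (∀ E ⊆ I, Neg E → ¬ satAll v E)
    have hmod : ∀ E ⊆ I, (∀ E' ⊆ E, ¬ Neg E') → F (fun x => x ∈ E ∨ D E x) := by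
      intro E hE hn
      have hsub : ∀ A ⊆ I, satAll (fun x => x ∈ E ∨ D E x) A → A ⊆ E := by
        intro A hA hs x hx
        rcases hs x hx with h | ⟨E', M', _, hm, hS'⟩
        · exact h
        · exact (hdis x (hA hx) ((hS _ hS').2.1 hm)).elim
      constructor
      · intro A M hAM hs m hm
        exact Or.inr ⟨A, M, hsub A (hS _ hAM).1 hs, hm, hAM⟩
      · intro A hA hneg hs
        exact hn A (hsub A hA hs) hneg
    have hL : ∀ E M, (E, M) ∈ S → supports F E M := by
      intro E M hEM
      refine ⟨⟨_, hmod E (hS _ hEM).1 ?_, fun x hx => Or.inl hx⟩, fun v hv hs => hv.1 E M hEM hs⟩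
      rintro E' hE' ⟨M', h1, h2, h3, h4, h5⟩
      exact hinc ⟨E, E', M, M', hE', h1, h2, hEM, h3, h4, h5⟩
    have hK : ∀ E M, E ⊆ I → M ⊆ C → M ≠ ∅ → supports F E M →
        (E, M) ∈ S ∨ ∃ E', lt E' E ∧ (E', M) ∈ S := by
      intro E M hE hM hne hsup
      by_contra hcon
      push Not at hcon
      obtain ⟨⟨v, hv, hvE⟩, hent⟩ := hsup
      have hn : ∀ E' ⊆ E, ¬ Neg E' := fun E' hE' hneg =>
        hv.2 E' (hE'.trans hE) hneg (hsat v _ _ hE' hvE)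
      refine hn E (Finset.Subset.refl _) ⟨M, hM, hne, hcon.1, ?_, hcon.2⟩
      intro m hm
      rcases hent _ (hmod E hE hn) (fun x hx => Or.inl hx) m hm with h | h
      · exact (hdis m (hE h) (hM hm)).elim
      · exact h
    refine ⟨F, fun E M => ⟨fun h => ?_, ?_⟩⟩
    · obtain ⟨h1, h2, h3⟩ := hS _ h
      refine ⟨h1, h2, h3, hL E M h, ?_⟩
      intro E' hE' hlt hs
      rcases hK E' M hE' h2 h3 hs with h' | ⟨E'', hlt', h'⟩
      · exact hmin ⟨E, E', M, h, h', hlt⟩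
      · exact hmin ⟨E, E'', M, h, h', hlt_trans _ _ _ hlt' hlt⟩
    · rintro ⟨h1, h2, h3, h4, h5⟩
      rcases hK E M h1 h2 h3 h4 with h' | ⟨E'', hlt', h'⟩
      · exact h'
      · exact (h5 E'' (hS _ h').1 hlt' (hL _ _ h')).elim
end

section
/- If a set S of explanations over disjoint hypotheses I and manifestations C satisfies consequential monotony, then there exist a finite set A of new variables disjoint from I ∪ C and a propositional formula F over hypotheses I ∪ A and manifestations C such that S = focus(⟨F, I∪A, C⟩, I ∪ C). -/
variable {V : Type*}

/-- Consequential monotony: whenever `E ⇒ M ∈ S` and `M'` is a nonempty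
subset of `M`, also `E ⇒ M' ∈ S`. -/
def consMonot (S : Set (Finset V × Finset V)) : Prop :=
  ∀ E M M' : Finset V, (E, M) ∈ S → M' ⊆ M → M' ≠ ∅ → (E, M') ∈ S

/-- If a set `S` of explanations over disjoint hypotheses `I` and
manifestations `C` satisfies consequential monotony, then there are a finite
set `A` of new variables disjoint from `I ∪ C` and a formula `F` over
hypotheses `I ∪ A` and manifestations `C` such that
`S = focus(⟨F, I ∪ A, C⟩, I ∪ C)`. -/
theorem consequential_enough [Infinite V] [DecidableEq V]
    (I C : Finset V) (hdisj : Disjoint I C)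
    (S : Set (Finset V × Finset V))
    (hS : ∀ p ∈ S, p.1 ⊆ I ∧ p.2 ⊆ C ∧ p.2 ≠ ∅)
    (hcm : consMonot S) :
    ∃ A : Finset V, Disjoint A (I ∪ C) ∧
      ∃ F : (V → Prop) → Prop, S = focus F (I ∪ A) C (I ∪ C) := by
  classical
  have hfin : S.Finite := by
    apply Set.Finite.subset (((I.powerset ×ˢ C.powerset : Finset _)).finite_toSet)
    intro p hp
    obtain ⟨h1, h2, -⟩ := hS p hp
    simp [h1, h2]
  have hSf : Finite S := hfin
  have hinf : Infinite {x : V // x ∉ I ∪ C} :=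
    ((I ∪ C).finite_toSet.infinite_compl).to_subtype
  obtain ⟨g, hg⟩ := exists_injective_nat S
  obtain ⟨f, hf, hfn⟩ : ∃ f : S → V, Function.Injective f ∧ ∀ p, f p ∉ I ∪ C :=
    ⟨fun p => (Infinite.natEmbedding {x : V // x ∉ I ∪ C} (g p)).1,
      fun p q h => hg ((Infinite.natEmbedding _).injective (Subtype.ext h)),
      fun p => (Infinite.natEmbedding {x : V // x ∉ I ∪ C} (g p)).2⟩
  obtain ⟨A, hA⟩ : ∃ A : Finset V, ∀ x, x ∈ A ↔ ∃ p, f p = x :=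
    ⟨(Set.finite_range f).toFinset, fun x => by simp⟩
  have hAn : ∀ x ∈ A, x ∉ I ∧ x ∉ C := by
    intro x hx
    obtain ⟨p, rfl⟩ := (hA x).1 hx
    simpa using hfn p
  have hIC : ∀ x ∈ I, x ∉ C := fun x h h' => Finset.disjoint_left.1 hdisj h h'
  refine ⟨A, ?_, fun v => (∀ a ∈ A, ¬ v a) ∨ ∃ p : S, (∀ a ∈ A, v a ↔ a = f p) ∧
    (∀ x ∈ I, v x → x ∈ p.1.1) ∧ ((∀ x ∈ p.1.1, v x) → ∀ m ∈ p.1.2, v m), ?_⟩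
  · rw [Finset.disjoint_left]
    intro x hx
    have := hAn x hx
    simp [this]
  ext ⟨E, M⟩
  constructor
  · intro hp
    obtain ⟨h1, h2, h3⟩ := hS _ hp
    simp only at h1 h2 h3
    have hfA : f ⟨_, hp⟩ ∈ A := (hA _).2 ⟨_, rfl⟩
    have hfI := hAn _ hfA
    refine ⟨?_, ?_, h3, {f ⟨_, hp⟩}, ?_, ∅, by simp, ?_, ?_, ?_, ?_, ?_⟩
    · intro x hx
      simp [h1 hx]
    · intro x hx
      simp [h2 hx]
    · simp [hfA, hfI]
    · intro x hx
      simp only [Finset.mem_union, Finset.mem_singleton] at hx ⊢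
      rcases hx with hx | rfl
      · exact Or.inl (h1 hx)
      · exact Or.inr hfA
    · simpa using h2
    · simpa using h3
    · refine ⟨fun x => x ∈ E ∨ x = f ⟨_, hp⟩ ∨ x ∈ M, Or.inr ⟨⟨_, hp⟩, ?_, ?_, ?_⟩, ?_⟩
      · intro a ha
        have := hAn a ha
        have h4 := @h1 a
        have h5 := @h2 a
        tauto
      · intro x hx hx'
        rcases hx' with h | h | h
        · exact h
        · exact absurd (h ▸ hx) hfI.1
        · exact absurd (h2 h) (hIC x hx)
      · intro _ m hm
        exact Or.inr (Or.inr hm)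
      · intro x hx
        simp only [Finset.mem_union, Finset.mem_singleton] at hx
        tauto
    · rintro v (hv | ⟨q, hq1, -, hq3⟩) hE
      · exact absurd (hE _ (by simp)) (hv _ hfA)
      · have h4 : v (f ⟨_, hp⟩) := hE _ (by simp)
        have h5 := hf ((hq1 _ hfA).1 h4)
        subst h5
        intro m hm
        simp only [Finset.union_empty] at hm
        exact hq3 (fun x hx => hE x (Finset.mem_union_left _ hx)) m hm
  · rintro ⟨h1, h2, h3, E', hE', M', -, -, -, -, ⟨v, hv, hvE⟩, hent⟩
    simp only at h1 h2 h3 hvE hent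
    have hEI : ∀ x ∈ E, x ∈ I := by
      intro x hx
      have h4 := h1 hx
      have h5 := hAn x
      simp only [Finset.mem_inter, Finset.mem_union] at h4
      tauto
    have hMC : ∀ x ∈ M, x ∈ C := fun x hx => (Finset.mem_inter.1 (h2 hx)).1
    have hEA : ∀ x ∈ E', x ∈ A := by
      intro x hx
      have h4 := hE' hx
      simp only [Finset.mem_sdiff, Finset.mem_union] at h4
      tauto
    obtain ⟨m, hm⟩ := Finset.nonempty_iff_ne_empty.2 h3
    rcases hv with hv | ⟨p, hp1, hp2, hp3⟩
    · have h4 := hent (fun x => x ∈ E) (Or.inl fun a ha h => (hAn a ha).1 (hEI a h)) (by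
        intro x hx
        rcases Finset.mem_union.1 hx with h | h
        · exact h
        · exact absurd (hvE x hx) (hv x (hEA x h)))
      exact absurd (hMC m hm) (hIC m (hEI m (h4 m (Finset.mem_union_left _ hm))))
    · obtain ⟨hpI, hpC, -⟩ := hS _ p.2
      have hfA : f p ∈ A := (hA _).2 ⟨_, rfl⟩
      have hfI := hAn _ hfA
      have hsub : E ⊆ p.1.1 := fun x hx =>
        hp2 x (hEI x hx) (hvE x (Finset.mem_union_left _ hx))
      have h4 := hent (fun x => x ∈ E ∨ x = f p ∨ (p.1.1 ⊆ E ∧ x ∈ p.1.2))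
        (Or.inr ⟨p, ?_, ?_, ?_⟩) ?_
      · have h5 : ∀ x ∈ M, p.1.1 ⊆ E ∧ x ∈ p.1.2 := by
          intro x hx
          rcases h4 x (Finset.mem_union_left _ hx) with h | h | h
          · exact absurd (hMC x hx) (hIC x (hEI x h))
          · exact absurd (h ▸ hMC x hx) hfI.2
          · exact h
        have h6 : p.1.1 = E := Finset.Subset.antisymm (h5 m hm).1 hsub
        refine hcm E p.1.2 M ?_ (fun x hx => (h5 x hx).2) h3
        rw [← h6]
        exact p.2
      · intro a ha
        have := hAn a ha
        have h4 := hEI a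
        have h5 := @hpC a
        tauto
      · intro x hx hx'
        rcases hx' with h | h | h
        · exact hsub h
        · exact absurd (h ▸ hx) hfI.1
        · exact absurd (hpC h.2) (hIC x hx)
      · intro h x hx
        refine Or.inr (Or.inr ⟨fun y hy => ?_, hx⟩)
        rcases h y hy with h | h | h
        · exact h
        · exact absurd (h ▸ hpI hy) hfI.1
        · exact absurd (hpC h.2) (hIC y (hpI hy))
      · intro x hx
        rcases Finset.mem_union.1 hx with h | h
        · exact Or.inl h
        · exact Or.inr (Or.inl ((hp1 x (hEA x h)).1 (hvE x hx)))
end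

section
/- Consequential monotony characterizes abductive forgetting: a set S of explanations over disjoint hypotheses I and manifestations C satisfies consequential monotony if and only if there exist a finite set A of new variables disjoint from I ∪ C and a propositional formula F over hypotheses I ∪ A and manifestations C such that S = focus(⟨F, I∪A, C⟩, I ∪ C). -/
variable {V : Type*}

theorem exists_code_aux [Infinite V] [DecidableEq V] (D : Finset V)
    (P : Finset (Finset V × Finset V)) :
    ∃ f : Finset V × Finset V → V, (∀ p ∈ P, ∀ q ∈ P, f p = f q → p = q) ∧
      ∀ p, f p ∉ D := by
  have hinf : ((D : Set V)ᶜ).Infinite := D.finite_toSet.infinite_compl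
  let g : ℕ ↪ ((D : Set V)ᶜ : Set V) := hinf.natEmbedding
  let e := P.equivFin
  classical
  refine ⟨fun p => if h : p ∈ P then (g (e ⟨p, h⟩) : V) else (g 0 : V), ?_, ?_⟩
  · intro p hp q hq h
    simp only [hp, hq, dif_pos] at h
    have h1 := g.injective (Subtype.ext h)
    have h2 := e.injective (Fin.ext h1)
    simpa using h2
  · intro p
    dsimp only
    split_ifs with h
    · exact fun hh => (g (e ⟨p, h⟩)).2 (Finset.mem_coe.2 hh)
    · exact fun hh => (g 0).2 (Finset.mem_coe.2 hh)

/-- Consequential monotony characterizes abductive forgetting: a set `S` of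
explanations over disjoint hypotheses `I` and manifestations `C` satisfies
consequential monotony if and only if there are a finite set `A` of new
variables disjoint from `I ∪ C` and a formula `F` over hypotheses `I ∪ A`
and manifestations `C` such that `S = focus(⟨F, I ∪ A, C⟩, I ∪ C)`. -/
theorem consequential_is_forget [Infinite V] [DecidableEq V]
    (I C : Finset V) (hdisj : Disjoint I C)
    (S : Set (Finset V × Finset V))
    (hS : ∀ p ∈ S, p.1 ⊆ I ∧ p.2 ⊆ C ∧ p.2 ≠ ∅) :
    consMonot S ↔
      ∃ A : Finset V, Disjoint A (I ∪ C) ∧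
        ∃ F : (V → Prop) → Prop, S = focus F (I ∪ A) C (I ∪ C) := by
  constructor
  · intro hmon
    obtain ⟨f, hinj, hnot⟩ := exists_code_aux (I ∪ C) (I.powerset ×ˢ C.powerset)
    have hP : ∀ p ∈ S, p ∈ I.powerset ×ˢ C.powerset := by
      intro p hp
      have := hS p hp
      simp [this.1, this.2.1]
    have hA : Disjoint ((I.powerset ×ˢ C.powerset).image f) (I ∪ C) := by
      rw [Finset.disjoint_left]
      intro a ha
      obtain ⟨p, -, rfl⟩ := Finset.mem_image.1 ha
      exact hnot p
    have hIC : ∀ x, x ∈ I → x ∈ C → False := fun x h1 h2 =>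
      Finset.disjoint_left.1 hdisj h1 h2
    have hfI : ∀ p, f p ∉ I := fun p h => hnot p (Finset.mem_union_left _ h)
    have hfC : ∀ p, f p ∉ C := fun p h => hnot p (Finset.mem_union_right _ h)
    refine ⟨_, hA, fun v => (∃ E0 ⊆ I, v = (· ∈ E0)) ∨
      (∃ p ∈ S, ∃ E0 ⊂ p.1, v = (· ∈ insert (f p) E0)) ∨
      (∃ p ∈ S, v = (· ∈ insert (f p) (p.1 ∪ p.2))), ?_⟩
    ext ⟨E, M⟩
    constructor
    · intro hp
      obtain ⟨h1, h2, h3⟩ := hS _ hp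
      dsimp only at h1 h2 h3
      have hfA : f (E, M) ∈ (I.powerset ×ˢ C.powerset).image f :=
        Finset.mem_image_of_mem f (hP _ hp)
      have hne := hnot (E, M)
      refine ⟨?_, ?_, h3, {f (E, M)}, ?_, ∅, by simp, ?_, ?_, ?_, ?_, ?_⟩
      · intro x hx
        have := h1 hx
        simp [this]
      · intro x hx
        have := h2 hx
        simp [this]
      · rw [Finset.singleton_subset_iff, Finset.mem_sdiff]
        exact ⟨Finset.mem_union_right _ hfA, hne⟩
      · refine Finset.union_subset (h1.trans Finset.subset_union_left) ?_
        rw [Finset.singleton_subset_iff]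
        exact Finset.mem_union_right _ hfA
      · simpa using h2
      · simpa using h3
      · refine ⟨_, Or.inr (Or.inr ⟨_, hp, rfl⟩), ?_⟩
        intro x hx
        simp only [Finset.mem_union, Finset.mem_singleton, Finset.mem_insert] at hx ⊢
        tauto
      · intro v hF hv x hx
        have hx : x ∈ M := by simpa using hx
        have hvf : v (f (E, M)) := hv _ (by simp)
        have hvE : ∀ y ∈ E, v y := fun y hy => hv y (Finset.mem_union_left _ hy)
        rcases hF with ⟨E0, hE0, rfl⟩ | ⟨q, hq, E0, hE0, rfl⟩ | ⟨q, hq, rfl⟩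
        · exact absurd (hE0 hvf) (hfI _)
        · have hqS := hS q hq
          have heq : f (E, M) = f q := by
            rcases Finset.mem_insert.1 hvf with h | h
            · exact h
            · exact absurd (hqS.1 (hE0.1 h)) (hfI _)
          have := hinj _ (hP _ hp) _ (hP _ hq) heq
          subst this
          exfalso
          apply hE0.2
          intro y hy
          rcases Finset.mem_insert.1 (hvE y hy) with h | h
          · exact absurd (h1 hy) (h ▸ hfI _)
          · exact h
        · have hqS := hS q hq
          have heq : f (E, M) = f q := by
            rcases Finset.mem_insert.1 hvf with h | h
            · exact h
            · exact absurd (Finset.union_subset_union hqS.1 hqS.2.1 h) hne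
          have := hinj _ (hP _ hp) _ (hP _ hq) heq
          subst this
          simp [hx]
    · rintro ⟨h1, h2, h3, E', hE', M', hM', -, -, -, ⟨v, hF, hv⟩, hent⟩
      dsimp only at h1 h2 h3 hv hent
      have hMC : M ⊆ C := h2.trans Finset.inter_subset_left
      have hEI : E ⊆ I := by
        intro x hx
        have h := Finset.mem_inter.1 (h1 hx)
        rcases Finset.mem_union.1 h.1 with h' | h'
        · exact h'
        · exact absurd h.2 (Finset.disjoint_left.1 hA h')
      have hE'n : ∀ x ∈ E', x ∉ I ∪ C := fun x hx => (Finset.mem_sdiff.1 (hE' hx)).2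
      have hvM : ∀ y ∈ M, v y := fun y hy => hent v hF hv y (Finset.mem_union_left _ hy)
      have hvE : ∀ y ∈ E, v y := fun y hy => hv y (Finset.mem_union_left _ hy)
      have hvE' : ∀ y ∈ E', v y := fun y hy => hv y (Finset.mem_union_right _ hy)
      obtain ⟨m, hm⟩ := Finset.nonempty_iff_ne_empty.2 h3
      have hmC := hMC hm
      rcases hF with ⟨E0, hE0, rfl⟩ | ⟨q, hq, E0, hE0, rfl⟩ | ⟨q, hq, rfl⟩
      · exact (hIC m (hE0 (hvM m hm)) hmC).elim
      · rcases Finset.mem_insert.1 (hvM m hm) with h | h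
        · exact absurd hmC (h ▸ hfC q)
        · exact (hIC m ((hS q hq).1 (hE0.1 h)) hmC).elim
      · have hqS := hS q hq
        have hEq : E ⊆ q.1 := by
          intro x hx
          rcases Finset.mem_insert.1 (hvE x hx) with h | h
          · exact absurd (hEI hx) (h ▸ hfI q)
          · rcases Finset.mem_union.1 h with h | h
            · exact h
            · exact (hIC x (hEI hx) (hqS.2.1 h)).elim
        have hMq : M ⊆ q.2 := by
          intro x hx
          rcases Finset.mem_insert.1 (hvM x hx) with h | h
          · exact absurd (hMC hx) (h ▸ hfC q)
          · rcases Finset.mem_union.1 h with h | h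
            · exact (hIC x (hqS.1 h) (hMC hx)).elim
            · exact h
        by_cases hqE : q.1 ⊆ E
        · have : E = q.1 := Finset.Subset.antisymm hEq hqE
          subst this
          exact hmon q.1 q.2 M hq hMq h3
        · exfalso
          have := hent (· ∈ insert (f q) E) (Or.inr (Or.inl ⟨q, hq, E, ⟨hEq, hqE⟩, rfl⟩)) (by
            intro x hx
            rcases Finset.mem_union.1 hx with h | h
            · exact Finset.mem_insert_of_mem h
            · rcases Finset.mem_insert.1 (hvE' x h) with h' | h'
              · exact h' ▸ Finset.mem_insert_self _ _
              · exact absurd (Finset.union_subset_union hqS.1 hqS.2.1 h') (hE'n x h))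
            m (Finset.mem_union_left _ hm)
          rcases Finset.mem_insert.1 this with h | h
          · exact absurd hmC (h ▸ hfC q)
          · exact hIC m (hEI h) hmC
  · rintro ⟨A, -, F, rfl⟩ E M N ⟨h1, h2, h3, E', hE', M', hM', g1, g2, g3, g4, g5⟩ hN hN0
    dsimp only at h1 h2 h3 g1 g2 g3 g4 g5
    have hsub : N ∪ M' ⊆ M ∪ M' := Finset.union_subset_union_left hN
    refine ⟨h1, hN.trans h2, hN0, E', hE', M', hM', g1, hsub.trans g2, ?_, g4, ?_⟩
    · intro h
      exact hN0 (Finset.union_eq_empty.1 h).1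
    · intro v hv hs x hx
      exact g5 v hv hs x (hsub hx)
end

section
/- Forgetting a single hypothesis satisfies the conjunctive condition: for every propositional formula F over disjoint hypotheses I and manifestations C, and every set of variables R with C ⊆ R such that I ∖ R contains at most one variable, the set summarize(⟨F,I,C⟩,R) satisfies the conjunctive condition. -/
variable {V : Type*}

/-- Forgetting a single hypothesis satisfies the conjunctive condition: if
all manifestations are remembered and at most one hypothesis is forgotten,
then summarizing satisfies the conjunctive condition. -/
theorem single_forget_satisfies_conjCond [Fintype V] [DecidableEq V]
    (F : (V → Prop) → Prop) (I C R : Finset V)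
    (hdisj : Disjoint I C) (hCR : C ⊆ R) (hone : (I \ R).card ≤ 1) :
    conjCond (I ∩ R) (C ∩ R) (summarize F I C R) := by
  intro E M₁ M₂ hE h1 h2 n1 n2
  have key : ∀ A B : Finset V, A ⊆ I \ R → B ⊆ I \ R → A ⊆ B ∨ B ⊆ A := by
    intro A B hA hB
    rcases A.eq_empty_or_nonempty with rfl | ⟨a, ha⟩
    · left; simp
    · right
      intro b hb
      have : b = a := Finset.card_le_one.mp hone b (hB hb) a (hA ha)
      rwa [this]
  have satU : ∀ (v : V → Prop) (A B : Finset V),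
      satAll v (A ∪ B) ↔ satAll v A ∧ satAll v B := by
    intro v A B
    simp only [satAll, Finset.mem_union]
    exact ⟨fun h => ⟨fun x hx => h x (Or.inl hx), fun x hx => h x (Or.inr hx)⟩,
      fun h x hx => hx.elim (h.1 x) (h.2 x)⟩
  have mono : ∀ (v : V → Prop) (A B : Finset V), A ⊆ B → satAll v B → satAll v A :=
    fun v A B hAB h x hx => h x (hAB hx)
  have nU : M₁ ∪ M₂ ≠ ∅ := fun h => n1 (Finset.union_eq_empty.mp h).1
  constructor
  · rintro ⟨⟨_, _, A, hA, hAI, hAC, _, hAs, hAe⟩, ⟨_, _, B, hB, hBI, hBC, _, hBs, hBe⟩⟩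
    refine ⟨hE, Finset.union_subset h1 h2, ?_⟩
    rcases key A B hA hB with h | h
    · refine ⟨B, hB, hBI, Finset.union_subset hAC hBC, nU, hBs, fun v hv hs => ?_⟩
      exact (satU _ _ _).2 ⟨hAe v hv (mono v _ _ (Finset.union_subset_union_right h) hs),
        hBe v hv hs⟩
    · refine ⟨A, hA, hAI, Finset.union_subset hAC hBC, nU, hAs, fun v hv hs => ?_⟩
      exact (satU _ _ _).2 ⟨hAe v hv hs,
        hBe v hv (mono v _ _ (Finset.union_subset_union_right h) hs)⟩
  · rintro ⟨_, _, A, hA, hAI, hAC, _, hAs, hAe⟩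
    exact ⟨⟨hE, h1, A, hA, hAI, h1.trans Finset.inter_subset_left, n1, hAs,
        fun v hv hs => ((satU _ _ _).1 (hAe v hv hs)).1⟩,
      ⟨hE, h2, A, hA, hAI, h2.trans Finset.inter_subset_left, n2, hAs,
        fun v hv hs => ((satU _ _ _).1 (hAe v hv hs)).2⟩⟩
end
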